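/- Let ω ∈ ℂ with Im ω > 0, let Λ = {n + m·ω : n, m ∈ ℤ} ⊂ ℂ, and let π : ℂ → ℂ/Λ be the quotient map. Let E ⊆ ℂ/Λ be a simply-connected continuum, let L ⊂ ℂ be a line, let B be a connected component of π⁻¹(E), and let I be a bounded connected component of L \ B. Then π is injective on I. -/

import Mathlib

open Complex

/-- The lattice Λ = {n + m·ω : n, m ∈ ℤ} as an additive subgroup of ℂ. -/
noncomputable def Lambda (ω : ℂ) : AddSubgroup ℂ where
  carrier := {z : ℂ | ∃ n m : ℤ, z = (n : ℂ) + (m : ℂ) * ω}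
  add_mem' := by
    rintro x y ⟨n1, m1, rfl⟩ ⟨n2, m2, rfl⟩
    exact ⟨n1 + n2, m1 + m2, by push_cast; ring⟩
  zero_mem' := ⟨0, 0, by simp⟩
  neg_mem' := by
    rintro x ⟨n, m, rfl⟩
    exact ⟨-n, -m, by push_cast; ring⟩

/-- The quotient map π : ℂ → ℂ/Λ. -/
noncomputable def pr (ω : ℂ) : ℂ → ℂ ⧸ Lambda ω := QuotientAddGroup.mk' (Lambda ω)

/-- A line in ℂ. -/
def IsLine (L : Set ℂ) : Prop :=
  ∃ z₀ v : ℂ, v ≠ 0 ∧ L = {z | ∃ t : ℝ, z = z₀ + t * v}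

/-- A nondegenerate line segment in ℂ. -/
def IsSegment (B : Set ℂ) : Prop :=
  ∃ z₀ v : ℂ, v ≠ 0 ∧ B = {z | ∃ t : ℝ, t ∈ Set.Icc (0 : ℝ) 1 ∧ z = z₀ + t * v}

/-- A continuum: a compact connected set with more than one point. -/
def IsContinuum {X : Type*} [TopologicalSpace X] (E : Set X) : Prop :=
  IsCompact E ∧ IsConnected E ∧ E.Nontrivial

/-- E is wandering for A. -/
def Wandering {X : Type*} (A : X → X) (E : Set X) : Prop :=
  ∀ n m : ℕ, m < n → A^[n] '' E ∩ A^[m] '' E = ∅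

/-- A continuum in the torus is simply-connected. -/
def IsSCContinuum (ω : ℂ) (E : Set (ℂ ⧸ Lambda ω)) : Prop :=
  ∃ U : Set (ℂ ⧸ Lambda ω), IsOpen U ∧ SimplyConnectedSpace U ∧ E ⊆ U ∧ IsConnected (U \ E)

/-! ### Chords of planar continua -/

/-- A continuous logarithm of `g` differs by a constant from the principal logarithm of `u * g`
as long as `u * g` stays in the slit plane. -/
theorem sub_eq_log_sub_log_of_mem_slitPlane {X : Type*} [TopologicalSpace X]
    [PreconnectedSpace X] {h g : X → ℂ} (hc : Continuous h) (hg : ∀ x, exp (h x) = g x)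
    {u : ℂ} (hu : ∀ x, u * g x ∈ slitPlane) (x y : X) :
    h x - h y = log (u * g x) - log (u * g y) := by
  have gc : Continuous g := by
    have : g = fun x => exp (h x) := funext fun x => (hg x).symm
    rw [this]; fun_prop
  have hne : ∀ x, u * g x ≠ 0 := fun x => slitPlane_ne_zero (hu x)
  have hlc : Continuous fun x => log (u * g x) := (continuous_const.mul gc).clog hu
  have key := isCoveringMap_exp.eq_of_comp_eq (g₁ := fun z => h z - log (u * g z))
    (g₂ := fun _ => h y - log (u * g y)) (hc.sub hlc) continuous_const (by
      funext z
      apply Subtype.ext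
      have hz : g z ≠ 0 := right_ne_zero_of_mul (hne z)
      have hy : g y ≠ 0 := right_ne_zero_of_mul (hne y)
      have hu0 : u ≠ 0 := left_ne_zero_of_mul (hne y)
      simp only [Function.comp, exp_sub, hg, exp_log (hne _)]
      field_simp) y rfl
  have := congrFun key x
  linear_combination this

theorem neg_I_mul_mem_slitPlane {z : ℂ} (hz : z ≠ 0) (him : 0 ≤ z.im) : -I * z ∈ slitPlane := by
  rw [mem_slitPlane_iff]
  rcases him.lt_or_eq with h | h
  · left; simpa using h
  · right
    intro h'
    apply hz
    apply Complex.ext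
    · simpa using h'
    · simp [← h]

theorem I_mul_mem_slitPlane {z : ℂ} (hz : z ≠ 0) (him : z.im ≤ 0) : I * z ∈ slitPlane := by
  have := neg_I_mul_mem_slitPlane (neg_ne_zero.2 hz) (by simpa using him)
  simpa using this

theorem log_I_mul_ofReal_im {r : ℝ} (hr : 0 < r) : (log (I * r)).im = Real.pi / 2 := by
  rw [mul_comm, log_im, arg_real_mul _ hr, arg_I]

theorem log_neg_I_mul_ofReal_im {r : ℝ} (hr : 0 < r) :
    (log (-I * r)).im = -(Real.pi / 2) := by
  rw [mul_comm, log_im, arg_real_mul _ hr, arg_neg_I]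

/-- A path in the closed upper half plane between real points `a` and `b` has a horizontal chord
of every length `0 < c < b - a`. -/
theorem exists_add_eq_of_im_nonneg {γ : ℝ → ℂ} (hγ : Continuous γ) (him : ∀ t, 0 ≤ (γ t).im)
    {a b c s₀ s₁ : ℝ} (h₀ : γ s₀ = a) (h₁ : γ s₁ = b) (hc : 0 < c) (hab : c < b - a) :
    ∃ s t, γ s = γ t + c := by
  by_contra! hne
  have hne' : ∀ s t, γ s - γ t - c ≠ 0 := fun s t h => hne s t (by linear_combination h)
  obtain ⟨h, ⟨-, hh⟩, -⟩ := isCoveringMapOn_exp.existsUnique_continuousMap_lifts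
    (⟨fun p : ℝ × ℝ => γ p.1 - γ p.2 - c, by fun_prop⟩ : C(ℝ × ℝ, ℂ)) (a₀ := (0, 0))
    (exp_log (hne' 0 0)) (fun p => hne' p.1 p.2)
  have hexp : ∀ s t, exp (h (s, t)) = γ s - γ t - c := fun s t => congrFun hh (s, t)
  have e₁ := sub_eq_log_sub_log_of_mem_slitPlane (h := fun s => h (s, s₀)) (by fun_prop)
    (fun s => hexp s s₀) (fun s => neg_I_mul_mem_slitPlane (hne' _ _) (by simpa [h₀] using him s))
    s₁ s₀
  have e₂ := sub_eq_log_sub_log_of_mem_slitPlane (h := fun t => h (s₁, t)) (by fun_prop)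
    (fun t => hexp s₁ t) (fun t => I_mul_mem_slitPlane (hne' _ _) (by simpa [h₁] using him t))
    s₁ s₀
  have e₃ := sub_eq_log_sub_log_of_mem_slitPlane (h := fun s => h (s, s₁)) (by fun_prop)
    (fun s => hexp s s₁) (fun s => neg_I_mul_mem_slitPlane (hne' _ _) (by simpa [h₁] using him s))
    s₁ s₀
  have e₄ := sub_eq_log_sub_log_of_mem_slitPlane (h := fun t => h (s₀, t)) (by fun_prop)
    (fun t => hexp s₀ t) (fun t => I_mul_mem_slitPlane (hne' _ _) (by simpa [h₀] using him t))
    s₁ s₀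
  simp only [h₀, h₁] at e₁ e₂ e₃ e₄
  have r₁ : -I * ((b : ℂ) - a - c) = -I * ((b - a - c : ℝ) : ℂ) := by push_cast; ring
  have r₂ : ∀ z : ℂ, -I * (z - z - c) = I * c := fun z => by ring
  have r₃ : ∀ z : ℂ, I * (z - z - c) = -I * c := fun z => by ring
  have r₄ : I * ((b : ℂ) - a - c) = I * ((b - a - c : ℝ) : ℂ) := by push_cast; ring
  have r₅ : -I * ((a : ℂ) - b - c) = I * ((b - a + c : ℝ) : ℂ) := by push_cast; ring
  have r₆ : I * ((a : ℂ) - b - c) = -I * ((b - a + c : ℝ) : ℂ) := by push_cast; ring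
  rw [r₁, r₂] at e₁
  rw [r₃, r₄] at e₂
  rw [r₂, r₅] at e₃
  rw [r₆, r₃] at e₄
  have p₁ : 0 < b - a - c := by linarith
  have p₂ : 0 < b - a + c := by linarith
  have i₁ := congrArg im e₁
  have i₂ := congrArg im e₂
  have i₃ := congrArg im e₃
  have i₄ := congrArg im e₄
  simp only [sub_im, log_I_mul_ofReal_im, log_neg_I_mul_ofReal_im, hc, p₁, p₂] at i₁ i₂ i₃ i₄
  linarith [Real.pi_pos]

/-- The version of `exists_add_eq_of_im_nonneg` for the closed lower half plane. -/
theorem exists_add_eq_of_im_nonpos {γ : ℝ → ℂ} (hγ : Continuous γ) (him : ∀ t, (γ t).im ≤ 0)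
    {a b c s₀ s₁ : ℝ} (h₀ : γ s₀ = a) (h₁ : γ s₁ = b) (hc : 0 < c) (hab : c < b - a) :
    ∃ s t, γ s = γ t + c := by
  obtain ⟨s, t, h⟩ := exists_add_eq_of_im_nonneg
    (γ := fun t => (starRingEnd ℂ) (γ t)) (continuous_conj.comp hγ)
    (fun t => by simpa using him t) (a := a) (b := b) (by rw [h₀, conj_ofReal]) (by rw [h₁, conj_ofReal]) hc hab
  refine ⟨s, t, (starRingEnd ℂ).injective ?_⟩
  simpa using h

/-- A path that joins the part of the real line left of `x` to the part right of `x + c`, and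
meets the real line only in these parts, has a horizontal chord of length `c`. -/
theorem exists_add_eq_of_gap {f : ℝ → ℂ} (hf : Continuous f) {x c : ℝ} (hc : 0 < c)
    (h₀ : (f 0).im = 0) (h₀' : (f 0).re < x) (h₁ : (f 1).im = 0) (h₁' : x + c < (f 1).re)
    (hgap : ∀ t, (f t).im = 0 → (f t).re < x ∨ x + c < (f t).re) :
    ∃ s t, f s = f t + c := by
  have hre : Continuous fun t => (f t).re := by fun_prop
  have him : Continuous fun t => (f t).im := by fun_prop
  obtain ⟨t₁, ⟨ht₁, ht₁i, ht₁r⟩, hmin⟩ :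
      ∃ t, IsLeast {t | t ∈ Set.Icc (0 : ℝ) 1 ∧ (f t).im = 0 ∧ x + c ≤ (f t).re} t := by
    refine IsCompact.exists_isLeast (isCompact_Icc.inter_right
      ((isClosed_eq him continuous_const).inter (isClosed_le continuous_const hre))) ?_
    exact ⟨1, by simp, h₁, h₁'.le⟩
  obtain ⟨t₀, ⟨ht₀, ht₀i, ht₀r⟩, hmax⟩ :
      ∃ t, IsGreatest {t | t ∈ Set.Icc (0 : ℝ) t₁ ∧ (f t).im = 0 ∧ (f t).re ≤ x} t := by
    refine IsCompact.exists_isGreatest (isCompact_Icc.inter_right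
      ((isClosed_eq him continuous_const).inter (isClosed_le hre continuous_const))) ?_
    exact ⟨0, by simp [ht₁.1], h₀, h₀'.le⟩
  have hne : ∀ t ∈ Set.Ioo t₀ t₁, (f t).im ≠ 0 := by
    intro t ht h
    rcases hgap t h with h' | h'
    · exact ht.1.not_ge (hmax ⟨⟨ht₀.1.trans ht.1.le, ht.2.le⟩, h, h'.le⟩)
    · exact ht.2.not_ge (hmin ⟨⟨ht₀.1.trans ht.1.le, ht.2.le.trans ht₁.2⟩, h, h'.le⟩)
  have hsign : (∀ t ∈ Set.Ioo t₀ t₁, 0 ≤ (f t).im) ∨ ∀ t ∈ Set.Ioo t₀ t₁, (f t).im ≤ 0 := by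
    by_contra! hcon
    obtain ⟨⟨u, hu, hu'⟩, v, hv, hv'⟩ := hcon
    obtain ⟨w, hw, hw'⟩ := isPreconnected_Ioo.intermediate_value hu hv him.continuousOn
      ⟨hu'.le, hv'.le⟩
    exact hne w hw hw'
  have hends : ∀ t ∈ Set.Icc t₀ t₁, t ∉ Set.Ioo t₀ t₁ → (f t).im = 0 := by
    intro t ht ht'
    rcases ht.1.eq_or_lt with rfl | h
    · exact ht₀i
    rcases ht.2.eq_or_lt with rfl | h'
    · exact ht₁i
    exact absurd ⟨h, h'⟩ ht'
  have ecast : ∀ t, (f t).im = 0 → f t = ((f t).re : ℂ) := fun t h =>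
    Complex.ext (by simp) (by simpa using h)
  have hγ : Continuous fun t => f (Set.projIcc t₀ t₁ ht₀.2 t) :=
    hf.comp (continuous_subtype_val.comp continuous_projIcc)
  have g₀ : f (Set.projIcc t₀ t₁ ht₀.2 t₀) = ((f t₀).re : ℂ) := by
    rw [Set.projIcc_left]; exact ecast _ ht₀i
  have g₁ : f (Set.projIcc t₀ t₁ ht₀.2 t₁) = ((f t₁).re : ℂ) := by
    rw [Set.projIcc_right]; exact ecast _ ht₁i
  have hlt : c < (f t₁).re - (f t₀).re := by
    rcases hgap t₀ ht₀i with h | h <;> linarith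
  have hex : ∃ s t, f (Set.projIcc t₀ t₁ ht₀.2 s) = f (Set.projIcc t₀ t₁ ht₀.2 t) + c := by
    rcases hsign with h | h
    · refine exists_add_eq_of_im_nonneg hγ (fun t => ?_) g₀ g₁ hc hlt
      by_cases hm : (Set.projIcc t₀ t₁ ht₀.2 t : ℝ) ∈ Set.Ioo t₀ t₁
      · exact h _ hm
      · exact (hends _ (Subtype.property _) hm).ge
    · refine exists_add_eq_of_im_nonpos hγ (fun t => ?_) g₀ g₁ hc hlt
      by_cases hm : (Set.projIcc t₀ t₁ ht₀.2 t : ℝ) ∈ Set.Ioo t₀ t₁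
      · exact h _ hm
      · exact (hends _ (Subtype.property _) hm).le
  obtain ⟨s, t, h⟩ := hex
  exact ⟨_, _, h⟩

/-- If a compact connected set `B` has real points on both sides of a segment `[x, x + c]` of the
real line that it does not meet, then `B` meets its translate by `c`. -/
theorem IsCompact.exists_add_mem_of_gap {B : Set ℂ} (hB : IsCompact B) (hBc : IsPreconnected B)
    {x c a b : ℝ} (hc : 0 < c) (ha : (a : ℂ) ∈ B) (hb : (b : ℂ) ∈ B) (hax : a < x)
    (hxb : x + c < b) (hgap : ∀ t ∈ Set.Icc x (x + c), (t : ℂ) ∉ B) :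
    ∃ p ∈ B, p + c ∈ B := by
  by_contra! hcon
  have hBt : IsCompact ((fun z => z + (c : ℂ)) '' B) := hB.image (by fun_prop)
  have hseg : IsCompact ((fun t : ℝ => (t : ℂ)) '' Set.Icc x (x + c)) :=
    isCompact_Icc.image continuous_ofReal
  have hd₁ : Disjoint B ((fun z => z + (c : ℂ)) '' B) := by
    rw [Set.disjoint_right]
    rintro _ ⟨z, hz, rfl⟩
    exact hcon z hz
  have hd₂ : Disjoint B ((fun t : ℝ => (t : ℂ)) '' Set.Icc x (x + c)) := by
    rw [Set.disjoint_right]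
    rintro _ ⟨t, ht, rfl⟩
    exact hgap t ht
  obtain ⟨δ₁, hδ₁, hD₁⟩ := hd₁.exists_thickenings hB hBt.isClosed
  obtain ⟨δ₂, hδ₂, hD₂⟩ := hd₂.exists_thickenings hB hseg.isClosed
  set δ := min δ₁ δ₂
  have hδ : 0 < δ := lt_min hδ₁ hδ₂
  set N := Metric.thickening δ B
  have hBN : B ⊆ N := Metric.self_subset_thickening hδ B
  have hNo : IsOpen N := Metric.isOpen_thickening
  have hNc : IsConnected N := by
    refine ⟨⟨a, hBN ha⟩, ?_⟩
    have : N = (fun p : ℂ × ℂ => p.1 + p.2) '' (B ×ˢ Metric.ball 0 δ) := by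
      ext z
      simp only [N, Metric.mem_thickening_iff, Set.mem_image, Set.mem_prod, Prod.exists,
        mem_ball_zero_iff]
      constructor
      · rintro ⟨w, hw, h⟩
        exact ⟨w, z - w, ⟨hw, by rwa [← dist_eq_norm]⟩, by ring⟩
      · rintro ⟨w, u, ⟨hw, h⟩, rfl⟩
        exact ⟨w, hw, by simpa [dist_eq_norm] using h⟩
    rw [this]
    exact (hBc.prod (convex_ball 0 δ).isPreconnected).image _ (by fun_prop)
  have hNp := hNo.isConnected_iff_isPathConnected.1 hNc
  obtain ⟨γ, hγ⟩ := hNp.joinedIn _ (hBN ha) _ (hBN hb)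
  have hmem : ∀ t, γ.extend t ∈ N := fun t => hγ _
  obtain ⟨s, t, hst⟩ := exists_add_eq_of_gap (f := γ.extend) γ.continuous_extend (x := x) hc
    (by simp) (by simpa using hax) (by simp) (by simpa using hxb) (by
      intro t ht
      by_contra! hcon'
      refine Set.disjoint_left.1 hD₂ (Metric.thickening_mono (min_le_right _ _) _ (hmem t))
        (Metric.self_subset_thickening hδ₂ _ ⟨(γ.extend t).re, hcon', ?_⟩)
      exact Complex.ext (by simp) (by simp [ht]))
  refine Set.disjoint_left.1 hD₁ (Metric.thickening_mono (min_le_left _ _) _ (hmem s)) ?_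
  obtain ⟨w, hw, hd⟩ := Metric.mem_thickening_iff.1 (hmem t)
  rw [hst, Metric.mem_thickening_iff]
  exact ⟨w + c, ⟨w, hw, rfl⟩, by simpa using hd.trans_le (min_le_left _ _)⟩

/-- If `x` and `x + c v` lie in a bounded component of the complement of a continuum `B` in the
line `z₀ + ℝ v`, then `B` meets its translate by `c v`. -/
theorem exists_add_mem_of_mem_bounded_component {B : Set ℂ} (hB : IsCompact B)
    (hBc : IsPreconnected B) {z₀ v z : ℂ} (hv : v ≠ 0)
    (hbdd : Bornology.IsBounded
      (connectedComponentIn ({w | ∃ t : ℝ, w = z₀ + t * v} \ B) z))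
    {x c : ℝ} (hc : 0 < c)
    (hx : z₀ + x * v ∈ connectedComponentIn ({w | ∃ t : ℝ, w = z₀ + t * v} \ B) z)
    (hy : z₀ + (x + c : ℝ) * v ∈ connectedComponentIn ({w | ∃ t : ℝ, w = z₀ + t * v} \ B) z) :
    ∃ p ∈ B, p + c * v ∈ B := by
  set L : Set ℂ := {w | ∃ t : ℝ, w = z₀ + t * v}
  set I := connectedComponentIn (L \ B) z
  set ℓ : ℝ → ℂ := fun t => z₀ + t * v
  have ℓc : Continuous ℓ := by fun_prop
  set φ : ℂ → ℂ := fun w => (w - z₀) / v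
  have φℓ : ∀ t, φ (ℓ t) = t := fun t => by simp [φ, ℓ, hv]
  have ℓ_of_φ : ∀ w (t : ℝ), φ w = t → w = ℓ t := fun w t h => by
    simp only [φ, ℓ] at h ⊢
    rw [← h]; field_simp; ring
  have φc : Continuous φ := by fun_prop
  have hIB : ∀ w ∈ I, w ∉ B := fun w hw => (connectedComponentIn_subset _ _ hw).2
  have hsub : ∀ S : Set ℝ, IsPreconnected S → (∀ t ∈ S, ℓ t ∉ B) →
      (∃ t ∈ S, ℓ t ∈ I) → ∀ t ∈ S, ℓ t ∈ I := by
    rintro S hS hSB ⟨t, ht, htI⟩ s hs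
    have h := (hS.image ℓ ℓc.continuousOn).subset_connectedComponentIn (F := L \ B)
      (Set.mem_image_of_mem ℓ ht) (by
        rintro _ ⟨r, hr, rfl⟩
        exact ⟨⟨r, rfl⟩, hSB r hr⟩)
    have h' : connectedComponentIn (L \ B) (ℓ t) = I := (connectedComponentIn_eq htI).symm
    rw [h'] at h
    exact h (Set.mem_image_of_mem ℓ hs)
  have hpre : (ℓ ⁻¹' I).OrdConnected := by
    have : ℓ ⁻¹' I = (fun w => (φ w).re) '' I := by
      ext t
      constructor
      · intro h
        exact ⟨ℓ t, h, by simp [φℓ]⟩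
      · rintro ⟨w, hw, rfl⟩
        obtain ⟨s, hs⟩ := (connectedComponentIn_subset _ _ hw).1
        obtain rfl : w = ℓ s := hs
        simpa [φℓ] using hw
    rw [this]
    exact (isPreconnected_connectedComponentIn.image _
      (continuous_re.comp φc).continuousOn).ordConnected
  obtain ⟨M, hM⟩ : ∃ M : ℝ, ∀ t, ℓ t ∈ I → |t| ≤ M := by
    obtain ⟨M, hM⟩ := hbdd.exists_norm_le
    refine ⟨(M + ‖z₀‖) / ‖v‖, fun t ht => ?_⟩
    rw [le_div_iff₀ (norm_pos_iff.2 hv)]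
    have e : (t : ℂ) * v = ℓ t - z₀ := by simp [ℓ]
    calc |t| * ‖v‖ = ‖(t : ℂ) * v‖ := by simp
      _ ≤ ‖ℓ t‖ + ‖z₀‖ := by rw [e]; exact norm_sub_le _ _
      _ ≤ M + ‖z₀‖ := by gcongr; exact hM _ ht
  have hleft : ∃ a, a < x ∧ ℓ a ∈ B := by
    by_contra! hcon
    have h := hsub (Set.Iic x) isPreconnected_Iic (fun t ht => by
      rcases (Set.mem_Iic.1 ht).eq_or_lt with rfl | h
      · exact hIB _ hx
      · exact hcon t h) ⟨x, by simp, hx⟩ (min x (-M - 1)) (by simp)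
    have := neg_le_of_abs_le (hM _ h)
    linarith [min_le_right x (-M - 1)]
  have hright : ∃ b, x + c < b ∧ ℓ b ∈ B := by
    by_contra! hcon
    have h := hsub (Set.Ici (x + c)) isPreconnected_Ici (fun t ht => by
      rcases (Set.mem_Ici.1 ht).eq_or_lt with rfl | h
      · exact hIB _ hy
      · exact hcon t h) ⟨x + c, by simp, hy⟩ (max (x + c) (M + 1)) (by simp)
    have := le_of_abs_le (hM _ h)
    linarith [le_max_right (x + c) (M + 1)]
  obtain ⟨a, hax, ha⟩ := hleft
  obtain ⟨b, hxb, hb⟩ := hright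
  obtain ⟨_, ⟨p, hp, rfl⟩, q, hq, hqp⟩ := (hB.image φc).exists_add_mem_of_gap
    (hBc.image φ φc.continuousOn) hc ⟨ℓ a, ha, φℓ a⟩ ⟨ℓ b, hb, φℓ b⟩ hax hxb (by
      rintro t ht ⟨w, hw, hwt⟩
      rw [ℓ_of_φ w t hwt] at hw
      exact hIB _ (hpre.out hx hy ht) hw)
  refine ⟨p, hp, ?_⟩
  have : p + c * v = q := by
    simp only [φ] at hqp
    field_simp at hqp
    linear_combination -hqp
  rwa [this]

/-! ### Lifting to the plane -/

theorem discreteTopology_Lambda {ω : ℂ} (hω : 0 < ω.im) : DiscreteTopology (Lambda ω) := by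
  have hind : LinearIndependent ℝ ![(1 : ℂ), ω] := by
    rw [LinearIndependent.pair_iff]
    intro s t h
    have hi := congrArg im h
    have hr := congrArg re h
    simp at hi hr
    rcases hi with rfl | h'
    · simpa using hr
    · exact absurd h' hω.ne'
  let P : PeriodPair := ⟨1, ω, hind⟩
  have : Lambda ω = P.lattice.toAddSubgroup := by
    ext z
    rw [Submodule.mem_toAddSubgroup, PeriodPair.mem_lattice]
    simp [Lambda, P, eq_comm]
  rw [this]
  exact inferInstanceAs (DiscreteTopology P.lattice)

theorem pr_eq_pr_iff {ω x y : ℂ} : pr ω x = pr ω y ↔ y - x ∈ Lambda ω := by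
  rw [sub_eq_neg_add]
  exact QuotientAddGroup.eq

/-- A connected set over a simply connected open set `U` is contained in a single sheet. -/
theorem exists_section_of_isConnected {ω : ℂ} (hω : 0 < ω.im) {U : Set (ℂ ⧸ Lambda ω)}
    (hU : IsOpen U) [SimplyConnectedSpace U] {B : Set ℂ} (hB : IsConnected B)
    (hBU : B ⊆ pr ω ⁻¹' U) :
    ∃ s : C(U, ℂ), (∀ u, pr ω (s u) = u) ∧ ∀ z (hz : z ∈ B), s ⟨pr ω z, hBU hz⟩ = z := by
  have := discreteTopology_Lambda hω
  obtain ⟨z₀, hz₀⟩ := hB.nonempty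
  have hcov : IsCoveringMap (pr ω) :=
    ((Lambda ω).isAddQuotientCoveringMap_of_comm ⟨this⟩).isCoveringMap
  have : LocallyPathConnectedSpace (ℂ ⧸ Lambda ω) :=
    inferInstanceAs (LocallyPathConnectedSpace (Quotient _))
  have := hU.locallyPathConnectedSpace
  obtain ⟨s, ⟨hs₀, hs⟩, -⟩ := hcov.existsUnique_continuousMap_lifts
    (⟨Subtype.val, continuous_subtype_val⟩ : C(U, ℂ ⧸ Lambda ω)) ⟨pr ω z₀, hBU hz₀⟩ z₀ rfl
  have hsec : ∀ u : U, pr ω (s u) = u := fun u => congrFun hs u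
  refine ⟨s, hsec, fun z hz => ?_⟩
  have : PreconnectedSpace B := isPreconnected_iff_preconnectedSpace.1 hB.isPreconnected
  have key := hcov.eq_of_comp_eq (g₁ := fun w : B => s ⟨pr ω w, hBU w.2⟩)
    (g₂ := fun w : B => (w : ℂ)) (s.continuous.comp (by
      exact (hcov.continuous.comp continuous_subtype_val).subtype_mk _)) continuous_subtype_val
    (funext fun w => hsec _) ⟨z₀, hz₀⟩ hs₀
  exact congrFun key ⟨z, hz⟩

/-- A component of the preimage of a simply-connected continuum is compact and `π` is injective
on it. -/
theorem IsSCContinuum.isCompact_and_injOn_component {ω : ℂ} (hω : 0 < ω.im)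
    {E : Set (ℂ ⧸ Lambda ω)} (hE : IsContinuum E) (hSC : IsSCContinuum ω E) {z : ℂ}
    (hz : z ∈ pr ω ⁻¹' E) :
    IsCompact (connectedComponentIn (pr ω ⁻¹' E) z) ∧
      Set.InjOn (pr ω) (connectedComponentIn (pr ω ⁻¹' E) z) := by
  obtain ⟨U, hU, hUs, hEU, -⟩ := hSC
  set B := connectedComponentIn (pr ω ⁻¹' E) z
  have hBE : B ⊆ pr ω ⁻¹' E := connectedComponentIn_subset _ _
  have hBU : B ⊆ pr ω ⁻¹' U := fun w hw => hEU (hBE hw)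
  have hBc : IsConnected B := isConnected_connectedComponentIn_iff.2 hz
  have hzB : z ∈ B := mem_connectedComponentIn hz
  obtain ⟨s, hs, hsB⟩ := exists_section_of_isConnected hω hU hBc hBU
  have hEmb : Topology.IsEmbedding ((↑) : U → ℂ ⧸ Lambda ω) := Topology.IsEmbedding.subtypeVal
  have himg : ((↑) : U → ℂ ⧸ Lambda ω) '' ((↑) ⁻¹' E) = E := by
    rw [Subtype.image_preimage_coe, Set.inter_eq_right.2 hEU]
  have hE'c : IsCompact (((↑) : U → ℂ ⧸ Lambda ω) ⁻¹' E) := by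
    rw [hEmb.isCompact_iff, himg]; exact hE.1
  have hE'p : IsPreconnected (((↑) : U → ℂ ⧸ Lambda ω) ⁻¹' E) := by
    rw [← hEmb.isInducing.isPreconnected_image, himg]; exact hE.2.1.isPreconnected
  have hB : B = s '' (((↑) : U → ℂ ⧸ Lambda ω) ⁻¹' E) := by
    apply Set.Subset.antisymm
    · exact fun w hw => ⟨⟨pr ω w, hBU hw⟩, hBE hw, hsB w hw⟩
    · refine (hE'p.image s s.continuous.continuousOn).subset_connectedComponentIn
        ⟨⟨pr ω z, hBU hzB⟩, hz, hsB z hzB⟩ ?_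
      rintro _ ⟨u, hu, rfl⟩
      rw [Set.mem_preimage, hs]
      exact hu
  refine ⟨hB ▸ hE'c.image s.continuous, fun p hp q hq hpq => ?_⟩
  rw [← hsB p hp, ← hsB q hq]
  congr 2

/-- Lemma 3.2 (topology): for a simply-connected continuum E in the torus, a line L,
a connected component B of π⁻¹(E) and a bounded connected component I of L \ B,
the projection π is injective on I. -/
theorem proj_injOn_bounded_component (ω : ℂ) (hω : 0 < ω.im)
    (E : Set (ℂ ⧸ Lambda ω)) (hE : IsContinuum E) (hSC : IsSCContinuum ω E)
    (L : Set ℂ) (hL : IsLine L)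
    (B : Set ℂ)
    (hB : ∃ z ∈ pr ω ⁻¹' E, B = connectedComponentIn (pr ω ⁻¹' E) z)
    (I : Set ℂ)
    (hI : ∃ z ∈ L \ B, I = connectedComponentIn (L \ B) z)
    (hIbdd : Bornology.IsBounded I) :
    Set.InjOn (pr ω) I := by
  obtain ⟨z₁, hz₁, rfl⟩ := hB
  obtain ⟨z₀, v, hv, rfl⟩ := hL
  obtain ⟨z, -, rfl⟩ := hI
  obtain ⟨hBcpt, hBinj⟩ := hSC.isCompact_and_injOn_component hω hE hz₁
  have key : ∀ x y : ℝ, x < y →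
      z₀ + x * v ∈ connectedComponentIn
        ({w | ∃ t : ℝ, w = z₀ + t * v} \ connectedComponentIn (pr ω ⁻¹' E) z₁) z →
      z₀ + y * v ∈ connectedComponentIn
        ({w | ∃ t : ℝ, w = z₀ + t * v} \ connectedComponentIn (pr ω ⁻¹' E) z₁) z →
      pr ω (z₀ + x * v) ≠ pr ω (z₀ + y * v) := by
    intro x y hxy hx hy h
    obtain ⟨p, hp, hp'⟩ := exists_add_mem_of_mem_bounded_component hBcpt
      isPreconnected_connectedComponentIn hv hIbdd (sub_pos.2 hxy) hx
      (by rwa [add_sub_cancel])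
    have hpp : pr ω p = pr ω (p + (y - x : ℝ) * v) := by
      rw [pr_eq_pr_iff] at h ⊢
      convert h using 1
      push_cast
      ring
    have h0 := hBinj hp hp' hpp
    rw [left_eq_add, mul_eq_zero, ofReal_eq_zero] at h0
    exact h0.elim (sub_pos.2 hxy).ne' hv
  intro a ha b hb hab
  obtain ⟨x, rfl⟩ := (connectedComponentIn_subset _ _ ha).1
  obtain ⟨y, rfl⟩ := (connectedComponentIn_subset _ _ hb).1
  rcases lt_trichotomy x y with h | rfl | h
  · exact absurd hab (key x y h ha hb)
  · rfl
  · exact absurd hab.symm (key y x h hb ha)
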